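/- Let ⊢ Γ be a classical 𝓛_C-sequent. Then ⊢ Γ is provable in LLW if and only if the intuitionistic sequent Γ^[⊥] ⊢ (with empty stoup) is provable in ILZW. -/

import Mathlib

namespace Affine

/-- Intuitionistic formulas: the language 𝓛 (⊗, ⊸, &, ⊕, !, 1, ⊤, ⊥, 0)
together with the extra ILAL modality §. -/
inductive IForm : Type where
  | var (n : ℕ)
  | one
  | top
  | bot
  | zero
  | tensor (A B : IForm)
  | limp (A B : IForm)
  | and (A B : IForm)
  | or (A B : IForm)
  | bang (A : IForm)
  | para (A : IForm)

namespace IForm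

/-- membership in the language 𝓛 (no §) -/
def inL : IForm → Prop
  | para _ => False
  | tensor A B => inL A ∧ inL B
  | limp A B => inL A ∧ inL B
  | and A B => inL A ∧ inL B
  | or A B => inL A ∧ inL B
  | bang A => inL A
  | _ => True

/-- membership in the ⊥-free language 𝓛⁺ -/
def inLp : IForm → Prop
  | para _ => False
  | bot => False
  | tensor A B => inLp A ∧ inLp B
  | limp A B => inLp A ∧ inLp B
  | and A B => inLp A ∧ inLp B
  | or A B => inLp A ∧ inLp B
  | bang A => inLp A
  | _ => True

/-- {⊗,⊸,&,⊕,1,⊥}-formulas -/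
def inFLei : IForm → Prop
  | var _ => True
  | one => True
  | bot => True
  | tensor A B => inFLei A ∧ inFLei B
  | limp A B => inFLei A ∧ inFLei B
  | and A B => inFLei A ∧ inFLei B
  | or A B => inFLei A ∧ inFLei B
  | _ => False

/-- {⊗,⊸,&,⊕,1}-formulas -/
def inFLeiP : IForm → Prop
  | var _ => True
  | one => True
  | tensor A B => inFLeiP A ∧ inFLeiP B
  | limp A B => inFLeiP A ∧ inFLeiP B
  | and A B => inFLeiP A ∧ inFLeiP B
  | or A B => inFLeiP A ∧ inFLeiP B
  | _ => False

/-- purely implicational ({⊸}-) formulas -/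
def inImp : IForm → Prop
  | var _ => True
  | limp A B => inImp A ∧ inImp B
  | _ => False

/-- {⊸,!}-formulas -/
def inImpBang : IForm → Prop
  | var _ => True
  | limp A B => inImpBang A ∧ inImpBang B
  | bang A => inImpBang A
  | _ => False

/-- {⊸,!,§}-formulas: the language of ILAL -/
def inLAL : IForm → Prop
  | var _ => True
  | limp A B => inLAL A ∧ inLAL B
  | bang A => inLAL A
  | para A => inLAL A
  | _ => False

end IForm

/-- A parametrized intuitionistic sequent calculus: `K` is the set of allowed
formulas (the fragment), `ax` the set of non-logical axioms, and the remaining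
fields tell which optional rules are available. -/
structure ICalc where
  K : IForm → Prop
  ax : Set IForm
  wL : Prop      -- unrestricted left weakening (W)
  wR : Prop      -- right weakening (W')
  bD : Prop      -- dereliction (!D)
  bP : Prop      -- promotion (!P)
  bF : Prop      -- functorial promotion (!F)
  bW : Prop      -- !-weakening (!W), for linear systems
  lB : Prop      -- the ILAL rule (!)
  lP : Prop      -- the ILAL rule (§)

/-- Provability of an intuitionistic sequent `Γ ⊢ X` (X a stoup) in the
parametrized calculus `C`. -/
inductive IPrv (C : ICalc) : Multiset IForm → Option IForm → Prop where
  | axiom' {B} : B ∈ C.ax → IPrv C 0 (some B)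
  | init {A} : C.K A → IPrv C {A} (some A)
  | oneR : C.K .one → IPrv C 0 (some .one)
  | botL : C.K .bot → IPrv C {.bot} none
  | topR {Γ} : C.K .top → (∀ A ∈ Γ, C.K A) → IPrv C Γ (some .top)
  | zeroL {Γ X} : C.K .zero → (∀ A ∈ Γ, C.K A) → (∀ A, X = some A → C.K A) →
      IPrv C (.zero ::ₘ Γ) X
  | cut {Γ Δ X A} : IPrv C Γ (some A) → IPrv C (A ::ₘ Δ) X → IPrv C (Γ + Δ) X
  | oneL {Γ X} : C.K .one → IPrv C Γ X → IPrv C (.one ::ₘ Γ) X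
  | botR {Γ} : C.K .bot → IPrv C Γ none → IPrv C Γ (some .bot)
  | limpL {Γ Δ X A B} : C.K (.limp A B) → IPrv C Γ (some A) → IPrv C (B ::ₘ Δ) X →
      IPrv C (.limp A B ::ₘ (Γ + Δ)) X
  | limpR {Γ A B} : C.K (.limp A B) → IPrv C (A ::ₘ Γ) (some B) →
      IPrv C Γ (some (.limp A B))
  | tensorL {Γ X A B} : C.K (.tensor A B) → IPrv C (A ::ₘ B ::ₘ Γ) X →
      IPrv C (.tensor A B ::ₘ Γ) X
  | tensorR {Γ Δ A B} : C.K (.tensor A B) → IPrv C Γ (some A) → IPrv C Δ (some B) →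
      IPrv C (Γ + Δ) (some (.tensor A B))
  | withL1 {Γ X A B} : C.K (.and A B) → IPrv C (A ::ₘ Γ) X → IPrv C (.and A B ::ₘ Γ) X
  | withL2 {Γ X A B} : C.K (.and A B) → IPrv C (B ::ₘ Γ) X → IPrv C (.and A B ::ₘ Γ) X
  | withR {Γ A B} : C.K (.and A B) → IPrv C Γ (some A) → IPrv C Γ (some B) →
      IPrv C Γ (some (.and A B))
  | plusL {Γ X A B} : C.K (.or A B) → IPrv C (A ::ₘ Γ) X → IPrv C (B ::ₘ Γ) X →
      IPrv C (.or A B ::ₘ Γ) X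
  | plusR1 {Γ A B} : C.K (.or A B) → IPrv C Γ (some A) → IPrv C Γ (some (.or A B))
  | plusR2 {Γ A B} : C.K (.or A B) → IPrv C Γ (some B) → IPrv C Γ (some (.or A B))
  | bangD {Γ X A} : C.bD → C.K (.bang A) → IPrv C (A ::ₘ Γ) X → IPrv C (.bang A ::ₘ Γ) X
  | bangP {Γ : Multiset IForm} {A} : C.bP → C.K (.bang A) → (∀ B ∈ Γ, C.K (.bang B)) →
      IPrv C (Γ.map .bang) (some A) → IPrv C (Γ.map .bang) (some (.bang A))
  | bangF {Γ : Multiset IForm} {A} : C.bF → C.K (.bang A) → (∀ B ∈ Γ, C.K (.bang B)) →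
      IPrv C Γ (some A) → IPrv C (Γ.map .bang) (some (.bang A))
  | weakL {Γ X A} : C.wL → C.K A → IPrv C Γ X → IPrv C (A ::ₘ Γ) X
  | bangW {Γ X A} : C.bW → C.K (.bang A) → IPrv C Γ X → IPrv C (.bang A ::ₘ Γ) X
  | bangC {Γ X A} : C.K (.bang A) → IPrv C (.bang A ::ₘ .bang A ::ₘ Γ) X →
      IPrv C (.bang A ::ₘ Γ) X
  | weakR {Γ A} : C.wR → C.K A → IPrv C Γ none → IPrv C Γ (some A)
  | lalBang {A} {E : Multiset IForm} : C.lB → C.K (.bang A) →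
      (∀ B ∈ E, C.K (.bang B)) → Multiset.card E ≤ 1 → IPrv C E (some A) →
      IPrv C (E.map .bang) (some (.bang A))
  | lalPara {Γ Δ : Multiset IForm} {A} : C.lP → C.K (.para A) → (∀ B ∈ Γ, C.K (.bang B)) →
      (∀ B ∈ Δ, C.K (.para B)) → IPrv C (Γ + Δ) (some A) →
      IPrv C (Γ.map .bang + Δ.map .para) (some (.para A))

/-- ILZW with a set of non-logical axioms. -/
def ILZWc (Φ : Set IForm) : ICalc :=
  ⟨IForm.inL, Φ, True, False, True, True, False, False, False, False⟩

/-- ILZW' = ILZW + right weakening, with a set of non-logical axioms. -/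
def ILZWpc (Φ : Set IForm) : ICalc :=
  ⟨IForm.inL, Φ, True, True, True, True, False, False, False, False⟩

/-- ILLW: the ⊥-free fragment of ILZW. -/
def ILLWc (Φ : Set IForm) : ICalc :=
  ⟨IForm.inLp, Φ, True, False, True, True, False, False, False, False⟩

/-- IEZW: intuitionistic elementary affine logic with bottom. -/
def IEZWc (Φ : Set IForm) : ICalc :=
  ⟨IForm.inL, Φ, True, False, False, False, True, False, False, False⟩

/-- IELW: the ⊥-free fragment of IEZW. -/
def IELWc (Φ : Set IForm) : ICalc :=
  ⟨IForm.inLp, Φ, True, False, False, False, True, False, False, False⟩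

/-- FLei: the {⊗,⊸,&,⊕,1,⊥}-fragment of ILZW. -/
def FLeic (Φ : Set IForm) : ICalc :=
  ⟨IForm.inFLei, Φ, True, False, True, True, False, False, False, False⟩

/-- FLew: the {⊗,⊸,&,⊕,1,⊥}-fragment of ILZW'. -/
def FLewc (Φ : Set IForm) : ICalc :=
  ⟨IForm.inFLei, Φ, True, True, True, True, False, False, False, False⟩

/-- FLei⁺: the {⊗,⊸,&,⊕,1}-fragment of ILZW. -/
def FLeiPc (Φ : Set IForm) : ICalc :=
  ⟨IForm.inFLeiP, Φ, True, False, True, True, False, False, False, False⟩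

/-- BCK: the {⊸}-fragment of ILZW. -/
def BCKc (Φ : Set IForm) : ICalc :=
  ⟨IForm.inImp, Φ, True, False, True, True, False, False, False, False⟩

/-- The {⊸,!}-fragment of ILLW. -/
def ImpBangILLWc (Φ : Set IForm) : ICalc :=
  ⟨IForm.inImpBang, Φ, True, False, True, True, False, False, False, False⟩

/-- ILL: intuitionistic linear logic (no unrestricted weakening, only !W). -/
def ILLc (Φ : Set IForm) : ICalc :=
  ⟨IForm.inLp, Φ, False, False, True, True, False, True, False, False⟩

/-- BCI: the {⊸}-fragment of ILL. -/
def BCIc (Φ : Set IForm) : ICalc :=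
  ⟨IForm.inImp, Φ, False, False, True, True, False, True, False, False⟩

/-- ILAL: intuitionistic light affine logic. -/
def ILALc (Φ : Set IForm) : ICalc :=
  ⟨IForm.inLAL, Φ, True, False, False, False, False, False, True, True⟩

/-- Classical formulas: literals p, p⊥ and the connectives ⊗, ⅋, &, ⊕, 1, ⊥, ⊤, 0, !, ?. -/
inductive CForm : Type where
  | pos (n : ℕ)
  | neg (n : ℕ)
  | one
  | bot
  | top
  | zero
  | tensor (A B : CForm)
  | par (A B : CForm)
  | and (A B : CForm)
  | or (A B : CForm)
  | bang (A : CForm)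
  | quest (A : CForm)

namespace CForm

/-- De Morgan (involutive) negation. -/
def dual : CForm → CForm
  | pos n => neg n
  | neg n => pos n
  | one => bot
  | bot => one
  | top => zero
  | zero => top
  | tensor A B => par A.dual B.dual
  | par A B => tensor A.dual B.dual
  | and A B => or A.dual B.dual
  | or A B => and A.dual B.dual
  | bang A => quest A.dual
  | quest A => bang A.dual

/-- the propositional variable `x` occurs in the formula -/
def hasVar (x : ℕ) : CForm → Prop
  | pos n => n = x
  | neg n => n = x
  | one => False
  | bot => False
  | top => False
  | zero => False
  | tensor A B => hasVar x A ∨ hasVar x B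
  | par A B => hasVar x A ∨ hasVar x B
  | and A B => hasVar x A ∨ hasVar x B
  | or A B => hasVar x A ∨ hasVar x B
  | bang A => hasVar x A
  | quest A => hasVar x A

/-- {⊗,⅋,&,⊕,1,⊥}-formulas (the language of InFLew) -/
def inMALL : CForm → Prop
  | pos _ => True
  | neg _ => True
  | one => True
  | bot => True
  | tensor A B => inMALL A ∧ inMALL B
  | par A B => inMALL A ∧ inMALL B
  | and A B => inMALL A ∧ inMALL B
  | or A B => inMALL A ∧ inMALL B
  | _ => False

end CForm

/-- A parametrized one-sided classical sequent calculus. -/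
structure CCalc where
  K : CForm → Prop
  ax : Set CForm
  wk : Prop      -- unrestricted weakening (W)
  der : Prop     -- dereliction (?)
  prom : Prop    -- promotion (!)
  funcF : Prop   -- the functorial rule (F) of ELLW
  qW : Prop      -- ?-weakening (?W), for LL

/-- Provability of a one-sided sequent `⊢ Γ` in the parametrized calculus `C`. -/
inductive CPrv (C : CCalc) : Multiset CForm → Prop where
  | axiom' {B} : B ∈ C.ax → CPrv C {B}
  | init {A} : C.K A → C.K A.dual → CPrv C {A, A.dual}
  | one : C.K .one → CPrv C {.one}
  | top {Γ} : C.K .top → (∀ A ∈ Γ, C.K A) → CPrv C (.top ::ₘ Γ)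
  | cut {Γ Δ A} : CPrv C (A ::ₘ Γ) → CPrv C (A.dual ::ₘ Δ) → CPrv C (Γ + Δ)
  | bot {Γ} : C.K .bot → CPrv C Γ → CPrv C (.bot ::ₘ Γ)
  | tensor {Γ Δ A B} : C.K (.tensor A B) → CPrv C (A ::ₘ Γ) → CPrv C (B ::ₘ Δ) →
      CPrv C (.tensor A B ::ₘ (Γ + Δ))
  | par {Γ A B} : C.K (.par A B) → CPrv C (A ::ₘ B ::ₘ Γ) → CPrv C (.par A B ::ₘ Γ)
  | with' {Γ A B} : C.K (.and A B) → CPrv C (A ::ₘ Γ) → CPrv C (B ::ₘ Γ) →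
      CPrv C (.and A B ::ₘ Γ)
  | plus1 {Γ A B} : C.K (.or A B) → CPrv C (A ::ₘ Γ) → CPrv C (.or A B ::ₘ Γ)
  | plus2 {Γ A B} : C.K (.or A B) → CPrv C (B ::ₘ Γ) → CPrv C (.or A B ::ₘ Γ)
  | der {Γ A} : C.der → C.K (.quest A) → CPrv C (A ::ₘ Γ) → CPrv C (.quest A ::ₘ Γ)
  | prom {Γ : Multiset CForm} {A} : C.prom → C.K (.bang A) → (∀ B ∈ Γ, C.K (.quest B)) →
      CPrv C (A ::ₘ Γ.map .quest) → CPrv C (.bang A ::ₘ Γ.map .quest)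
  | wk {Γ A} : C.wk → C.K A → CPrv C Γ → CPrv C (A ::ₘ Γ)
  | questW {Γ A} : C.qW → C.K (.quest A) → CPrv C Γ → CPrv C (.quest A ::ₘ Γ)
  | questC {Γ A} : C.K (.quest A) → CPrv C (.quest A ::ₘ .quest A ::ₘ Γ) →
      CPrv C (.quest A ::ₘ Γ)
  | funcF {Γ : Multiset CForm} {A} : C.funcF → C.K (.bang A) → (∀ B ∈ Γ, C.K (.quest B)) →
      CPrv C (A ::ₘ Γ) → CPrv C (.bang A ::ₘ Γ.map .quest)

/-- LLW: classical affine logic, with a set of non-logical axioms. -/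
def LLWc (Φ : Set CForm) : CCalc :=
  ⟨fun _ => True, Φ, True, True, True, False, False⟩

/-- ELLW: classical elementary affine logic. -/
def ELLWc (Φ : Set CForm) : CCalc :=
  ⟨fun _ => True, Φ, True, False, False, True, False⟩

/-- InFLew: the {⊗,⅋,&,⊕,1,⊥}-fragment of LLW. -/
def InFLewc (Φ : Set CForm) : CCalc :=
  ⟨CForm.inMALL, Φ, True, False, False, False, False⟩

/-- LL: classical linear logic (weakening restricted to ?W). -/
def LLc (Φ : Set CForm) : CCalc :=
  ⟨fun _ => True, Φ, False, True, True, False, True⟩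

/-- The translation (·)^[F] of classical formulas into intuitionistic formulas,
where ¬_F B := B ⊸ F. -/
def trF (F : IForm) : CForm → IForm
  | .pos n => .limp (.var n) F
  | .neg n => .var n
  | .one => .limp .one F
  | .bot => .one
  | .top => .zero
  | .zero => .limp .zero F
  | .tensor B C => .limp (.limp (trF F B) F) (trF F C)
  | .par B C => .limp (.limp (trF F B) (.limp (trF F C) F)) F
  | .and B C => .or (trF F B) (trF F C)
  | .or B C => .limp (.or (.limp (trF F B) F) (.limp (trF F C) F)) F
  | .bang B => .limp (.bang (.limp (trF F B) F)) F
  | .quest B => .bang (trF F B)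

/-- The embedding (·)̲ of ⊥-free intuitionistic formulas into classical formulas. -/
def emb : IForm → CForm
  | .var n => .pos n
  | .one => .one
  | .top => .top
  | .bot => .bot
  | .zero => .zero
  | .tensor A B => .tensor (emb A) (emb B)
  | .limp A B => .par (emb A).dual (emb B)
  | .and A B => .and (emb A) (emb B)
  | .or A B => .or (emb A) (emb B)
  | .bang A => .bang (emb A)
  | .para A => .bang (emb A)

end Affine

namespace Affine

open scoped Pointwise

section Orthogonality

variable {M : Type*} [AddCommMonoid M] {P X Y : Set M}

/-- The orthogonal of a set with respect to a pole `P` in a commutative monoid. -/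
def orth (P X : Set M) : Set M := {m | ∀ x ∈ X, x + m ∈ P}

theorem mem_orth {m : M} : m ∈ orth P X ↔ ∀ x ∈ X, x + m ∈ P := Iff.rfl

theorem orth_anti (h : X ⊆ Y) : orth P Y ⊆ orth P X := fun _ hm x hx => hm x (h hx)

theorem subset_orth_orth (P X : Set M) : X ⊆ orth P (orth P X) := fun x hx y hy => by
  rw [add_comm]; exact hy x hx

theorem orth_orth_orth (P X : Set M) : orth P (orth P (orth P X)) = orth P X :=
  (orth_anti (subset_orth_orth P X)).antisymm (subset_orth_orth P _)

theorem orth_union (P X Y : Set M) : orth P (X ∪ Y) = orth P X ∩ orth P Y := by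
  ext m
  simp only [mem_orth, Set.mem_inter_iff, Set.mem_union, or_imp, forall_and]

theorem add_subset_iff_subset_orth : X + Y ⊆ P ↔ Y ⊆ orth P X := by
  rw [Set.add_subset_iff]
  exact ⟨fun h y hy x hx => h x hx y hy, fun h x hx y hy => h hy x hx⟩

theorem orth_orth_add_orth_orth_subset (P X Y : Set M) :
    orth P (orth P X) + orth P (orth P Y) ⊆ orth P (orth P (X + Y)) := by
  rintro _ ⟨a, ha, b, hb, rfl⟩ z hz
  have hbz : ∀ x ∈ X, x + (b + z) ∈ P := fun x hx => by
    have := hb (x + z) fun y hy => by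
      have := hz (x + y) (Set.add_mem_add hx hy)
      rwa [show y + (x + z) = x + y + z by abel]
    rwa [show x + (b + z) = x + z + b by abel]
  have := ha _ hbz
  rwa [show z + (a + b) = b + z + a by abel]

end Orthogonality

namespace CForm

@[simp] theorem dual_dual (A : CForm) : A.dual.dual = A := by
  induction A <;> simp_all [dual]

end CForm

/-- A set of classical sequents closed under the cut-free rules of affine logic, with identity
axioms on literals only. -/
structure IsCutFreeClosed (P : Set (Multiset CForm)) : Prop where
  wk {Γ} (A) : Γ ∈ P → A ::ₘ Γ ∈ P
  init (n) : {.pos n, .neg n} ∈ P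
  one : {.one} ∈ P
  top : {.top} ∈ P
  tensor {Γ Δ A B} : A ::ₘ Γ ∈ P → B ::ₘ Δ ∈ P → .tensor A B ::ₘ (Γ + Δ) ∈ P
  par {Γ A B} : A ::ₘ B ::ₘ Γ ∈ P → .par A B ::ₘ Γ ∈ P
  and {Γ A B} : A ::ₘ Γ ∈ P → B ::ₘ Γ ∈ P → .and A B ::ₘ Γ ∈ P
  or_left {Γ A} (B) : A ::ₘ Γ ∈ P → .or A B ::ₘ Γ ∈ P
  or_right {Γ B} (A) : B ::ₘ Γ ∈ P → .or A B ::ₘ Γ ∈ P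
  bang {Γ : Multiset CForm} {A} : A ::ₘ Γ.map .quest ∈ P → .bang A ::ₘ Γ.map .quest ∈ P
  quest {Γ A} : A ::ₘ Γ ∈ P → .quest A ::ₘ Γ ∈ P
  contract {Γ A} : .quest A ::ₘ .quest A ::ₘ Γ ∈ P → .quest A ::ₘ Γ ∈ P

/-- The sequents consisting of `?`-formulas. -/
def questSequents : Set (Multiset CForm) := Set.range (Multiset.map .quest)

/-- The phase-semantic interpretation of the negation of a formula, with pole `P`. -/
def refuters (P : Set (Multiset CForm)) : CForm → Set (Multiset CForm)
  | .pos n => orth P (orth P {{.pos n}})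
  | .neg n => orth P {{.pos n}}
  | .one => orth P Set.univ
  | .bot => Set.univ
  | .top => orth P Set.univ
  | .zero => Set.univ
  | .tensor A B => orth P (orth P (refuters P A) + orth P (refuters P B))
  | .par A B => orth P (orth P (refuters P A + refuters P B))
  | .and A B => orth P (orth P (refuters P A ∪ refuters P B))
  | .or A B => refuters P A ∩ refuters P B
  | .bang A => orth P (orth P (refuters P A) ∩ questSequents)
  | .quest A => orth P (orth P (refuters P A ∩ questSequents))

section Phase

variable {P : Set (Multiset CForm)}

theorem orth_orth_univ (P : Set (Multiset CForm)) : orth P (orth P Set.univ) = Set.univ :=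
  Set.univ_subset_iff.1 (subset_orth_orth P _)

theorem orth_orth_refuters (P : Set (Multiset CForm)) (A : CForm) :
    orth P (orth P (refuters P A)) = refuters P A := by
  induction A with
  | or A B ihA ihB =>
    rw [refuters, ← ihA, ← ihB, ← orth_union, orth_orth_orth]
  | bot => exact orth_orth_univ P
  | zero => exact orth_orth_univ P
  | _ => simp only [refuters, orth_orth_orth]

theorem refuters_dual (P : Set (Multiset CForm)) (A : CForm) :
    refuters P A.dual = orth P (refuters P A) := by
  induction A with
  | and A B ihA ihB =>
    rw [CForm.dual, refuters, refuters, orth_orth_orth, orth_union, ihA, ihB]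
  | or A B ihA ihB =>
    simp only [CForm.dual, refuters, ihA, ihB, orth_union, orth_orth_refuters]
  | _ => simp_all only [CForm.dual, refuters, orth_orth_orth, orth_orth_refuters, orth_orth_univ]

theorem refuters_quest_subset (P : Set (Multiset CForm)) (A : CForm) :
    refuters P (.quest A) ⊆ refuters P A := by
  rw [← orth_orth_refuters P A]
  exact orth_anti (orth_anti Set.inter_subset_left)

theorem sum_refuters_quest_subset (P : Set (Multiset CForm)) (Γ : Multiset CForm) :
    ((Γ.map CForm.quest).map (refuters P)).sum ⊆
      orth P (orth P (((Γ.map CForm.quest).map (refuters P)).sum ∩ questSequents)) := by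
  induction Γ using Multiset.induction_on with
  | empty =>
    refine subset_trans ?_ (subset_orth_orth P _)
    exact fun x hx => ⟨hx, 0, by simp_all⟩
  | cons A Γ ih =>
    simp only [Multiset.map_cons, Multiset.sum_cons]
    refine (Set.add_subset_add subset_rfl ih).trans
      ((orth_orth_add_orth_orth_subset P _ _).trans (orth_anti (orth_anti ?_)))
    rintro _ ⟨x, ⟨hx, Δ, rfl⟩, y, ⟨hy, Θ, rfl⟩, rfl⟩
    exact ⟨Set.add_mem_add (subset_orth_orth P _ ⟨hx, Δ, rfl⟩) hy, Δ + Θ, Multiset.map_add _ _ _⟩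

namespace IsCutFreeClosed

theorem add_mem (hP : IsCutFreeClosed P) {Γ : Multiset CForm} (hΓ : Γ ∈ P)
    (Δ : Multiset CForm) : Δ + Γ ∈ P := by
  induction Δ using Multiset.induction_on with
  | empty => simpa
  | cons A Δ ih => rw [Multiset.cons_add]; exact hP.wk A ih

theorem contract_map_quest (hP : IsCutFreeClosed P) (Γ Δ : Multiset CForm)
    (h : Γ.map .quest + (Γ.map .quest + Δ) ∈ P) : Γ.map .quest + Δ ∈ P := by
  induction Γ using Multiset.induction_on generalizing Δ with
  | empty => simpa using h
  | cons A Γ ih =>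
    rw [Multiset.map_cons, Multiset.cons_add] at h ⊢
    rw [Multiset.cons_add, Multiset.add_cons] at h
    have := ih (.quest A ::ₘ Δ) (by simpa only [Multiset.add_cons] using hP.contract h)
    rwa [Multiset.add_cons] at this

theorem singleton_mem_refuters (hP : IsCutFreeClosed P) (A : CForm) : {A} ∈ refuters P A := by
  have key {A : CForm} (h : {A} ∈ refuters P A) {Γ} (hΓ : Γ ∈ orth P (refuters P A)) :
      A ::ₘ Γ ∈ P := hΓ _ h
  induction A with
  | pos n => exact subset_orth_orth P _ rfl
  | neg n => rintro _ rfl; exact hP.init n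
  | one => exact fun Γ _ => hP.add_mem hP.one Γ
  | top => exact fun Γ _ => hP.add_mem hP.top Γ
  | bot => trivial
  | zero => trivial
  | tensor A B ihA ihB =>
    rintro _ ⟨Γ, hΓ, Δ, hΔ, rfl⟩
    rw [add_comm, Multiset.singleton_add]
    exact hP.tensor (key ihA hΓ) (key ihB hΔ)
  | par A B ihA ihB =>
    intro Γ hΓ
    rw [add_comm, Multiset.singleton_add]
    have := hΓ ({A} + {B}) (Set.add_mem_add ihA ihB)
    rw [add_assoc, Multiset.singleton_add, Multiset.singleton_add] at this
    exact hP.par this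
  | and A B ihA ihB =>
    intro Γ hΓ
    rw [add_comm, Multiset.singleton_add]
    rw [orth_union] at hΓ
    exact hP.and (key ihA hΓ.1) (key ihB hΓ.2)
  | or A B ihA ihB =>
    rw [refuters, ← orth_orth_refuters P A, ← orth_orth_refuters P B]
    constructor <;> intro Γ hΓ <;> rw [add_comm, Multiset.singleton_add]
    · exact hP.or_left B (key ihA hΓ)
    · exact hP.or_right A (key ihB hΓ)
  | bang A ih =>
    rintro _ ⟨hΓ, Γ, rfl⟩
    rw [add_comm, Multiset.singleton_add]
    exact hP.bang (key ih hΓ)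
  | quest A ih =>
    refine subset_orth_orth P _ ⟨?_, {A}, rfl⟩
    rw [← orth_orth_refuters P A]
    intro Γ hΓ
    rw [add_comm, Multiset.singleton_add]
    exact hP.quest (key ih hΓ)

theorem sum_refuters_subset (hP : IsCutFreeClosed P) {Γ : Multiset CForm}
    (h : CPrv (LLWc ∅) Γ) : (Γ.map (refuters P)).sum ⊆ P := by
  induction h with
  | axiom' h => exact h.elim
  | @init A _ _ =>
    simp only [Multiset.insert_eq_cons, Multiset.map_cons, Multiset.map_singleton,
      Multiset.sum_cons, Multiset.sum_singleton, refuters_dual]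
    exact add_subset_iff_subset_orth.2 subset_rfl
  | one =>
    simp only [Multiset.map_singleton, Multiset.sum_singleton]
    intro m hm
    simpa using hm 0 trivial
  | top =>
    simp only [Multiset.map_cons, Multiset.sum_cons]
    exact add_subset_iff_subset_orth.2 fun m _ x hx => by
      rw [add_comm]; exact hx m trivial
  | cut _ _ ihΓ ihΔ =>
    simp only [Multiset.map_cons, Multiset.sum_cons, refuters_dual,
      add_subset_iff_subset_orth] at ihΓ ihΔ
    rw [Multiset.map_add, Multiset.sum_add, add_subset_iff_subset_orth]
    exact ihΔ.trans (orth_anti ihΓ)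
  | bot _ _ ih =>
    simp only [Multiset.map_cons, Multiset.sum_cons]
    rintro _ ⟨x, _, y, hy, rfl⟩
    exact hP.add_mem (ih hy) x
  | tensor _ _ _ ihΓ ihΔ =>
    rw [Multiset.map_cons, Multiset.sum_cons, add_subset_iff_subset_orth] at ihΓ ihΔ ⊢
    rw [Multiset.map_add, Multiset.sum_add]
    exact (Set.add_subset_add ihΓ ihΔ).trans (subset_orth_orth P _)
  | par _ _ ih =>
    simp only [Multiset.map_cons, Multiset.sum_cons, ← add_assoc,
      add_subset_iff_subset_orth, refuters, orth_orth_orth] at ih ⊢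
    exact ih
  | with' _ _ _ ihA ihB =>
    rw [Multiset.map_cons, Multiset.sum_cons, add_subset_iff_subset_orth] at ihA ihB ⊢
    rw [refuters, orth_orth_orth, orth_union]
    exact Set.subset_inter ihA ihB
  | plus1 _ _ ih =>
    simp only [Multiset.map_cons, Multiset.sum_cons] at ih ⊢
    exact (Set.add_subset_add Set.inter_subset_left subset_rfl).trans ih
  | plus2 _ _ ih =>
    simp only [Multiset.map_cons, Multiset.sum_cons] at ih ⊢
    exact (Set.add_subset_add Set.inter_subset_right subset_rfl).trans ih
  | der _ _ _ ih =>
    simp only [Multiset.map_cons, Multiset.sum_cons] at ih ⊢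
    exact (Set.add_subset_add (refuters_quest_subset P _) subset_rfl).trans ih
  | prom _ _ _ _ ih =>
    rw [Multiset.map_cons, Multiset.sum_cons, add_subset_iff_subset_orth] at ih ⊢
    exact (sum_refuters_quest_subset P _).trans
      (orth_anti (orth_anti (Set.inter_subset_inter_left _ ih)))
  | wk _ _ _ ih =>
    simp only [Multiset.map_cons, Multiset.sum_cons]
    rintro _ ⟨x, _, y, hy, rfl⟩
    exact hP.add_mem (ih hy) x
  | questW h => exact h.elim
  | questC _ _ ih =>
    simp only [Multiset.map_cons, Multiset.sum_cons] at ih ⊢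
    rw [add_subset_iff_subset_orth, refuters, orth_orth_orth]
    rintro y hy _ ⟨hx, Δ, rfl⟩
    have hx' := subset_orth_orth P _ (Set.mem_inter hx (Set.mem_range_self Δ))
    exact hP.contract_map_quest Δ y
      (ih (Set.add_mem_add hx' (Set.add_mem_add hx' hy)))
  | funcF h => exact h.elim

/-- Every sequent provable in affine logic belongs to each set closed under the cut-free rules:
cut elimination. -/
theorem mem_of_prv (hP : IsCutFreeClosed P) {Γ : Multiset CForm} (h : CPrv (LLWc ∅) Γ) :
    Γ ∈ P := by
  refine hP.sum_refuters_subset h ?_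
  clear h
  induction Γ using Multiset.induction_on with
  | empty => simp
  | cons A Γ ih =>
    rw [Multiset.map_cons, Multiset.sum_cons, ← Multiset.singleton_add]
    exact Set.add_mem_add (hP.singleton_mem_refuters A) ih

end IsCutFreeClosed

end Phase

section Translation

theorem inL_trF {F : IForm} (hF : F.inL) (A : CForm) : (trF F A).inL := by
  induction A <;> simp_all [trF, IForm.inL]

theorem IPrv.of_eq {C : ICalc} {Γ Δ : Multiset IForm} {X : Option IForm} (h : IPrv C Γ X)
    (e : Γ = Δ) : IPrv C Δ X := e ▸ h

theorem CPrv.of_eq {C : CCalc} {Γ Δ : Multiset CForm} (h : CPrv C Γ) (e : Γ = Δ) : CPrv C Δ :=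
  e ▸ h

variable {Φ : Set IForm} {Γ : Multiset IForm} {A : IForm}

theorem IPrv.neg_right (hA : A.inL) (h : IPrv (ILZWc Φ) (A ::ₘ Γ) none) :
    IPrv (ILZWc Φ) Γ (some (.limp A .bot)) :=
  .limpR ⟨hA, trivial⟩ (.botR trivial h)

theorem IPrv.neg_left (hA : A.inL) (h : IPrv (ILZWc Φ) Γ (some A)) :
    IPrv (ILZWc Φ) (.limp A .bot ::ₘ Γ) none :=
  (IPrv.limpL (Δ := 0) (C := ILZWc Φ) (A := A) (B := .bot) ⟨hA, trivial⟩ h (.botL trivial)).of_eq (by simp)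

theorem isCutFreeClosed_translation (Φ : Set IForm) :
    IsCutFreeClosed {Γ | IPrv (ILZWc Φ) (Γ.map (trF .bot)) none} := by
  have hL (A : CForm) : (trF .bot A).inL := inL_trF (F := .bot) trivial A
  constructor <;> simp only [Set.mem_ofPred_eq, Multiset.map_cons, Multiset.map_singleton,
    Multiset.map_add, Multiset.insert_eq_cons, trF]
  · exact fun A h => .weakL trivial (hL A) h
  · exact fun n => .neg_left trivial (.init trivial)
  · exact .neg_left trivial (.oneR trivial)
  · exact .zeroL trivial (by simp) (by simp)
  · exact fun hA hB => .limpL ⟨⟨hL _, trivial⟩, hL _⟩ (.neg_right (hL _) hA) hB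
  · exact fun {Γ A B} h => .neg_left ⟨hL _, hL _, trivial⟩ (.limpR ⟨hL _, hL _, trivial⟩
      (.neg_right (hL _) (h.of_eq (Multiset.cons_swap _ _ _))))
  · exact fun hA hB => .plusL ⟨hL _, hL _⟩ hA hB
  · exact fun B h => .neg_left ⟨⟨hL _, trivial⟩, hL _, trivial⟩
      (.plusR1 ⟨⟨hL _, trivial⟩, hL _, trivial⟩ (.neg_right (hL _) h))
  · exact fun B h => .neg_left ⟨⟨hL _, trivial⟩, hL _, trivial⟩
      (.plusR2 ⟨⟨hL _, trivial⟩, hL _, trivial⟩ (.neg_right (hL _) h))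
  · intro Γ A h
    have e : (Γ.map CForm.quest).map (trF .bot) = (Γ.map (trF .bot)).map .bang := by
      rw [Multiset.map_map, Multiset.map_map]
      rfl
    rw [e] at h ⊢
    refine .neg_left ⟨hL _, trivial⟩ (.bangP trivial ⟨hL _, trivial⟩ ?_ (.neg_right (hL _) h))
    intro B hB
    obtain ⟨D, -, rfl⟩ := Multiset.mem_map.1 hB
    exact hL D
  · exact fun h => .bangD trivial (hL _) h
  · exact fun h => .bangC (hL _) h

end Translation

section Embedding

/-- The classical reading of a stoup. -/
def embStoup : Option IForm → Multiset CForm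
  | none => 0
  | some A => {emb A}

variable {Φ : Set CForm} {Γ Δ : Multiset CForm} {A B : CForm}

theorem CPrv.init_swap (A : CForm) : CPrv (LLWc Φ) {A.dual, A} :=
  (CPrv.init (C := LLWc Φ) (A := A) trivial trivial).of_eq (Multiset.pair_comm _ _)

theorem CPrv.tensor_one (h : CPrv (LLWc Φ) (A ::ₘ Γ)) :
    CPrv (LLWc Φ) (.tensor A .one ::ₘ Γ) :=
  (CPrv.tensor (C := LLWc Φ) (Δ := 0) trivial h (.one trivial)).of_eq (by simp)

theorem CPrv.swap {C : CCalc} (h : CPrv C (A ::ₘ B ::ₘ Γ)) : CPrv C (B ::ₘ A ::ₘ Γ) :=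
  h.of_eq (Multiset.cons_swap _ _ _)

theorem IPrv.emb {Γ : Multiset IForm} {X : Option IForm} (h : IPrv (ILZWc ∅) Γ X) :
    CPrv (LLWc ∅) (Γ.map (fun A => (emb A).dual) + embStoup X) := by
  have add_singleton (Δ : Multiset CForm) (B) : Δ + {B} = B ::ₘ Δ := by
    rw [add_comm, Multiset.singleton_add]
  induction h with
  | axiom' h => exact h.elim
  | init => exact .init_swap _
  | oneR => exact .one trivial
  | botL => exact .one trivial
  | topR =>
    simp only [embStoup, add_singleton]
    exact .top trivial (by simp [LLWc])
  | zeroL =>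
    rw [Multiset.map_cons, Multiset.cons_add]
    exact .top trivial (by simp [LLWc])
  | cut _ _ ih₁ ih₂ =>
    simp only [Multiset.map_cons, Multiset.map_add, embStoup, Multiset.cons_add,
      add_singleton] at ih₁ ih₂ ⊢
    exact (ih₁.cut ih₂).of_eq (add_assoc _ _ _).symm
  | oneL _ _ ih => rw [Multiset.map_cons, Multiset.cons_add]; exact .bot trivial ih
  | botR _ _ ih =>
    simp only [embStoup, add_zero, add_singleton] at ih ⊢
    exact .bot trivial ih
  | limpL _ _ _ ih₁ ih₂ =>
    simp only [Multiset.map_cons, Multiset.map_add, embStoup, Multiset.cons_add,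
      add_singleton, add_assoc] at ih₁ ih₂ ⊢
    refine .tensor trivial ?_ ih₂
    rwa [CForm.dual_dual]
  | limpR _ _ ih =>
    simp only [Multiset.map_cons, embStoup, add_singleton] at ih ⊢
    exact .par trivial ih.swap
  | tensorL _ _ ih =>
    simp only [Multiset.map_cons, Multiset.cons_add] at ih ⊢
    exact .par trivial ih
  | tensorR _ _ _ ih₁ ih₂ =>
    simp only [Multiset.map_add, embStoup, add_singleton] at ih₁ ih₂ ⊢
    exact .tensor trivial ih₁ ih₂
  | withL1 _ _ ih =>
    simp only [Multiset.map_cons, Multiset.cons_add] at ih ⊢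
    exact .plus1 trivial ih
  | withL2 _ _ ih =>
    simp only [Multiset.map_cons, Multiset.cons_add] at ih ⊢
    exact .plus2 trivial ih
  | withR _ _ _ ih₁ ih₂ =>
    simp only [embStoup, add_singleton] at ih₁ ih₂ ⊢
    exact .with' trivial ih₁ ih₂
  | plusL _ _ _ ih₁ ih₂ =>
    simp only [Multiset.map_cons, Multiset.cons_add] at ih₁ ih₂ ⊢
    exact .with' trivial ih₁ ih₂
  | plusR1 _ _ ih =>
    simp only [embStoup, add_singleton] at ih ⊢
    exact .plus1 trivial ih
  | plusR2 _ _ ih =>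
    simp only [embStoup, add_singleton] at ih ⊢
    exact .plus2 trivial ih
  | bangD _ _ _ ih =>
    simp only [Multiset.map_cons, Multiset.cons_add] at ih ⊢
    exact .der trivial trivial ih
  | @bangP Γ A _ _ _ _ ih =>
    have e : (Γ.map IForm.bang).map (fun A => (Affine.emb A).dual) =
        (Γ.map fun A => (Affine.emb A).dual).map .quest := by
      rw [Multiset.map_map, Multiset.map_map]
      rfl
    simp only [embStoup, add_singleton, e] at ih ⊢
    exact .prom trivial trivial (fun _ _ => trivial) ih
  | bangF h => exact h.elim
  | weakL _ _ _ ih =>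
    rw [Multiset.map_cons, Multiset.cons_add]
    exact .wk trivial trivial ih
  | bangW h => exact h.elim
  | bangC _ _ ih =>
    simp only [Multiset.map_cons, Multiset.cons_add] at ih ⊢
    exact .questC trivial ih
  | weakR h => exact h.elim
  | lalBang h => exact h.elim
  | lalPara h => exact h.elim

theorem CPrv.emb_trF_bot (A : CForm) : CPrv (LLWc Φ) {emb (trF .bot A), A} := by
  induction A with
  | pos n => exact .par trivial (CPrv.bot (C := LLWc Φ) trivial (.init_swap _)).swap
  | neg n => exact .init trivial trivial
  | one => exact .wk trivial trivial (.one trivial)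
  | bot => exact .init trivial trivial
  | top => exact (CPrv.top (C := LLWc Φ) trivial (fun _ _ => trivial)).swap
  | zero => exact .par trivial (.top trivial (fun _ _ => trivial))
  | tensor B C ihB ihC =>
    refine .par trivial ?_
    simp only [emb, CForm.dual, CForm.dual_dual]
    refine (CPrv.tensor (C := LLWc Φ) trivial ihB.tensor_one.swap ihC.swap).of_eq ?_
    simp only [← Multiset.singleton_add]
    abel
  | par B C ihB ihC =>
    refine .par trivial (CPrv.swap (.bot trivial ?_))
    simp only [emb, CForm.dual, CForm.dual_dual]
    refine (CPrv.par (C := LLWc Φ) (A := B) (B := C) trivial ?_).swap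
    refine (CPrv.tensor (C := LLWc Φ) trivial ihB ihC.tensor_one).of_eq ?_
    simp only [← Multiset.singleton_add]
    abel
  | and B C ihB ihC =>
    exact CPrv.swap (.with' trivial (CPrv.swap (.plus1 trivial ihB))
      (CPrv.swap (.plus2 trivial ihC)))
  | or B C ihB ihC =>
    refine .par trivial (CPrv.swap (.bot trivial ?_))
    simp only [emb, CForm.dual, CForm.dual_dual]
    exact .with' trivial (CPrv.swap (.plus1 trivial ihB.tensor_one.swap))
      (CPrv.swap (.plus2 trivial ihC.tensor_one.swap))
  | bang B ih =>
    refine .par trivial (CPrv.swap (.bot trivial ?_))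
    simp only [emb, CForm.dual, CForm.dual_dual]
    exact CPrv.swap (CPrv.prom (C := LLWc Φ) (Γ := {.tensor (emb (trF .bot B)) .one})
      trivial trivial (fun _ _ => trivial) (CPrv.swap (.der trivial trivial ih.tensor_one)))
  | quest B ih =>
    exact CPrv.prom (C := LLWc Φ) (Γ := {B})
      trivial trivial (fun _ _ => trivial) (CPrv.swap (.der trivial trivial ih.swap))

theorem CPrv.of_map_emb_trF_bot (Γ Δ : Multiset CForm)
    (h : CPrv (LLWc Φ) (Γ.map (fun A => (emb (trF .bot A)).dual) + Δ)) :
    CPrv (LLWc Φ) (Γ + Δ) := by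
  induction Γ using Multiset.induction_on generalizing Δ with
  | empty => simpa using h
  | cons A Γ ih =>
    rw [Multiset.map_cons, Multiset.cons_add] at h
    have := ih (A ::ₘ Δ) ((CPrv.cut (CPrv.emb_trF_bot A) h).of_eq (by
      simp only [← Multiset.singleton_add]
      abel))
    rwa [Multiset.add_cons, ← Multiset.cons_add] at this

end Embedding

/-- `⊢ Γ` is provable in LLW iff `Γ^[⊥] ⊢` (empty stoup) is provable in ILZW. -/
theorem llw_iff_ilzw_translation (Γ : Multiset CForm) :
    CPrv (LLWc ∅) Γ ↔ IPrv (ILZWc ∅) (Γ.map (trF IForm.bot)) none := by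
  refine ⟨(isCutFreeClosed_translation ∅).mem_of_prv, fun h => ?_⟩
  have h' := h.emb
  rw [Multiset.map_map] at h'
  exact (CPrv.of_map_emb_trF_bot Γ 0 h').of_eq (add_zero Γ)

end Affine
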